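/- For all integers m, n, k ≥ 2, the poset m ⊕ n ⊕ k, regarded as a reflexive digraph via its order relation, is 2-Słupecki if and only if n > B(m,k) + 1. -/

import Mathlib

/-- A map is a digraph homomorphism if it sends arcs to arcs. -/
def IsHom {V W : Type*} (E : V → V → Prop) (F : W → W → Prop) (f : V → W) : Prop :=
  ∀ x y, E x y → F (f x) (f y)

/-- The arc relation of the `p`-th power digraph (componentwise arcs). -/
def PowE {V : Type*} (E : V → V → Prop) (p : ℕ) : (Fin p → V) → (Fin p → V) → Prop :=
  fun x y => ∀ i, E (x i) (y i)

/-- A `p`-ary operation is essentially unary: it factors as a homomorphism applied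
to one coordinate. -/
def EssUnary {V : Type*} (E : V → V → Prop) {p : ℕ} (f : (Fin p → V) → V) : Prop :=
  ∃ (i : Fin p) (g : V → V), IsHom E E g ∧ ∀ x, f x = g (x i)

/-- The arc relation of the digraph `Hom(G,H)`: `(f,g)` is an arc if `(f x, g y)` is an
arc of `H` whenever `(x,y)` is an arc of `G`. -/
def HomArc {V W : Type*} (E : V → V → Prop) (F : W → W → Prop) (f g : V → W) : Prop :=
  ∀ x y, E x y → F (f x) (g y)

/-- A digraph is Słupecki if every surjective `k`-ary polymorphism (`k ≥ 2`) is
essentially unary. -/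
def IsSlupecki {V : Type*} (E : V → V → Prop) : Prop :=
  ∀ k : ℕ, 2 ≤ k → ∀ f : (Fin k → V) → V,
    IsHom (PowE E k) E f → Function.Surjective f → EssUnary E f

/-- A digraph is idempotent trivial if every idempotent `p`-ary polymorphism (`p ≥ 2`)
is a projection. -/
def IdemTrivial {V : Type*} (E : V → V → Prop) : Prop :=
  ∀ p : ℕ, 2 ≤ p → ∀ f : (Fin p → V) → V, IsHom (PowE E p) E f →
    (∀ x : V, f (fun _ => x) = x) → ∃ i : Fin p, ∀ x, f x = x i

/-- Directed reachability inside the digraph `Hom(G,H)` (all intermediate vertices are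
homomorphisms). -/
def HomReach {V W : Type*} (E : V → V → Prop) (F : W → W → Prop) :
    (V → W) → (V → W) → Prop :=
  Relation.ReflTransGen (fun a b => IsHom E F a ∧ IsHom E F b ∧ HomArc E F a b)

/-- Reachability inside the symmetrization of the digraph `Hom(G,H)` (connected
components). -/
def HomSymReach {V W : Type*} (E : V → V → Prop) (F : W → W → Prop) :
    (V → W) → (V → W) → Prop :=
  Relation.ReflTransGen
    (fun a b => IsHom E F a ∧ IsHom E F b ∧ (HomArc E F a b ∨ HomArc E F b a))

/-- The ordinal sum `m ⊕ n ⊕ k`: three stacked antichains of sizes `m`, `n`, `k`,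
viewed as a reflexive digraph via its order relation. -/
def ordSum3 (m n k : ℕ) :
    (Fin m ⊕ Fin n ⊕ Fin k) → (Fin m ⊕ Fin n ⊕ Fin k) → Prop
  | Sum.inl a, Sum.inl a' => a = a'
  | Sum.inl _, Sum.inr _ => True
  | Sum.inr _, Sum.inl _ => False
  | Sum.inr (Sum.inl b), Sum.inr (Sum.inl b') => b = b'
  | Sum.inr (Sum.inl _), Sum.inr (Sum.inr _) => True
  | Sum.inr (Sum.inr _), Sum.inr (Sum.inl _) => False
  | Sum.inr (Sum.inr c), Sum.inr (Sum.inr c') => c = c'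

/-- `μ(m,k)`: the maximum of `α·γ + β·δ` over integers `0 < α, β < m`, `0 < γ, δ < k`
with `(m−α)(m−β) ≥ m−1` and `(k−γ)(k−δ) ≥ k−1`. -/
noncomputable def muBound (m k : ℕ) : ℕ :=
  sSup { v : ℕ | ∃ α β γ δ : ℕ,
    0 < α ∧ α < m ∧ 0 < β ∧ β < m ∧ 0 < γ ∧ γ < k ∧ 0 < δ ∧ δ < k ∧
    m - 1 ≤ (m - α) * (m - β) ∧ k - 1 ≤ (k - γ) * (k - δ) ∧
    v = α * γ + β * δ }

/-- `B(m,k) = max(μ(m,k), mk)`. -/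
noncomputable def Bmk (m k : ℕ) : ℕ := max (muBound m k) (m * k)

open Finset

section ThreeLayer

variable {V : Type*}

/-- `E` is the order relation of an ordinal sum of three antichains `A`, `B`, `C`. -/
structure IsThreeLayer (E : V → V → Prop) (A B C : Finset V) : Prop where
  refl : ∀ x, E x x
  cover : ∀ x, x ∈ A ∨ x ∈ B ∨ x ∈ C
  le_AB : ∀ a ∈ A, ∀ b ∈ B, E a b
  le_AC : ∀ a ∈ A, ∀ c ∈ C, E a c
  le_BC : ∀ b ∈ B, ∀ c ∈ C, E b c
  not_BA : ∀ b ∈ B, ∀ a ∈ A, ¬ E b a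
  not_CA : ∀ c ∈ C, ∀ a ∈ A, ¬ E c a
  not_CB : ∀ c ∈ C, ∀ b ∈ B, ¬ E c b
  eq_A : ∀ a ∈ A, ∀ a' ∈ A, E a a' → a = a'
  eq_B : ∀ b ∈ B, ∀ b' ∈ B, E b b' → b = b'
  eq_C : ∀ c ∈ C, ∀ c' ∈ C, E c c' → c = c'

/-- A binary operation preserving the relation `E`. -/
def Preserves (E : V → V → Prop) (F : V → V → V) : Prop :=
  ∀ x x' y y', E x x' → E y y' → E (F x y) (F x' y')

lemma Preserves.dual {E : V → V → Prop} {F : V → V → V} (h : Preserves E F) :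
    Preserves (flip E) F := fun _ _ _ _ hx hy => h _ _ _ _ hx hy

lemma Preserves.swap {E : V → V → Prop} {F : V → V → V} (h : Preserves E F) :
    Preserves E (flip F) := fun _ _ _ _ hx hy => h _ _ _ _ hy hx

open Classical in
/-- The elements `a` of `A` such that `F a y` lies in `A` for some `y` outside `A`. -/
noncomputable def spread (A : Finset V) (F : V → V → V) : Finset V :=
  {a ∈ A | ∃ y, y ∉ A ∧ F a y ∈ A}

lemma mem_spread {A : Finset V} {F : V → V → V} {a : V} :
    a ∈ spread A F ↔ a ∈ A ∧ ∃ y, y ∉ A ∧ F a y ∈ A := by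
  simp [spread]

lemma spread_subset {A : Finset V} {F : V → V → V} : spread A F ⊆ A :=
  fun _ ha => (mem_spread.1 ha).1

namespace IsThreeLayer

variable {E : V → V → Prop} {A B C : Finset V} {F : V → V → V}

lemma dual (h : IsThreeLayer E A B C) : IsThreeLayer (flip E) C B A where
  refl := h.refl
  cover x := by rcases h.cover x with h | h | h <;> simp [h]
  le_AB a ha b hb := h.le_BC b hb a ha
  le_AC a ha b hb := h.le_AC b hb a ha
  le_BC a ha b hb := h.le_AB b hb a ha
  not_BA a ha b hb := h.not_CB b hb a ha
  not_CA a ha b hb := h.not_CA b hb a ha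
  not_CB a ha b hb := h.not_BA b hb a ha
  eq_A a ha b hb hab := (h.eq_C b hb a ha hab).symm
  eq_B a ha b hb hab := (h.eq_B b hb a ha hab).symm
  eq_C a ha b hb hab := (h.eq_A b hb a ha hab).symm

lemma notMem_A_of_mem_B (h : IsThreeLayer E A B C) {b : V} (hb : b ∈ B) : b ∉ A :=
  fun ha => h.not_BA b hb b ha (h.refl b)

lemma notMem_A_of_mem_C (h : IsThreeLayer E A B C) {c : V} (hc : c ∈ C) : c ∉ A :=
  fun ha => h.not_CA c hc c ha (h.refl c)

lemma eq_of_le_A (h : IsThreeLayer E A B C) {x a : V} (ha : a ∈ A) (hxa : E x a) : x = a := by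
  rcases h.cover x with hx | hx | hx
  · exact h.eq_A x hx a ha hxa
  · exact (h.not_BA x hx a ha hxa).elim
  · exact (h.not_CA x hx a ha hxa).elim

lemma le_of_notMem_A (h : IsThreeLayer E A B C) {x a : V} (ha : a ∈ A) (hx : x ∉ A) :
    E a x := by
  rcases h.cover x with h' | h' | h'
  · exact (hx h').elim
  · exact h.le_AB a ha x h'
  · exact h.le_AC a ha x h'

lemma exists_le (h : IsThreeLayer E A B C) (hA : A.Nonempty) (x : V) : ∃ a ∈ A, E a x := by
  by_cases hx : x ∈ A
  · exact ⟨x, hx, h.refl x⟩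
  · obtain ⟨a, ha⟩ := hA
    exact ⟨a, ha, h.le_of_notMem_A ha hx⟩

/-- An element outside `A` and below an element of `B` equals it. -/
lemma eq_of_le_B (h : IsThreeLayer E A B C) {x b : V} (hb : b ∈ B) (hx : x ∉ A)
    (hxb : E x b) : x = b := by
  rcases h.cover x with h' | h' | h'
  · exact (hx h').elim
  · exact h.eq_B x h' b hb hxb
  · exact (h.not_CB x h' b hb hxb).elim

lemma exists_A_preimage (h : IsThreeLayer E A B C) (hF : Preserves E F)
    (hs : ∀ v, ∃ x y, F x y = v) {t : V} (ht : t ∈ A) :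
    ∃ a ∈ A, ∃ a' ∈ A, F a a' = t := by
  obtain ⟨x, y, rfl⟩ := hs t
  obtain ⟨a, ha, hax⟩ := h.exists_le ⟨_, ht⟩ x
  obtain ⟨a', ha', hay⟩ := h.exists_le ⟨_, ht⟩ y
  exact ⟨a, ha, a', ha', h.eq_of_le_A ht (hF _ _ _ _ hax hay)⟩

lemma notMem_A_of_notMem (h : IsThreeLayer E A B C) (hF : Preserves E F)
    (hs : ∀ v, ∃ x y, F x y = v) (hA : 2 ≤ #A) {x y : V} (hx : x ∉ A) (hy : y ∉ A) :
    F x y ∉ A := by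
  intro hxy
  obtain ⟨s, hsA, hne⟩ := exists_mem_ne (by omega : 1 < #A) (F x y)
  obtain ⟨a, ha, a', ha', rfl⟩ := h.exists_A_preimage hF hs hsA
  exact hne (h.eq_of_le_A hxy
    (hF _ _ _ _ (h.le_of_notMem_A ha hx) (h.le_of_notMem_A ha' hy)))

lemma mem_B_of_mem_B (h : IsThreeLayer E A B C) (hF : Preserves E F)
    (hs : ∀ v, ∃ x y, F x y = v) (hA : 2 ≤ #A) (hC : 2 ≤ #C) {x y : V}
    (hx : x ∈ B) (hy : y ∈ B) : F x y ∈ B := by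
  rcases h.cover (F x y) with h' | h' | h'
  · exact (h.notMem_A_of_notMem hF hs hA (h.notMem_A_of_mem_B hx)
      (h.notMem_A_of_mem_B hy) h').elim
  · exact h'
  · exact (h.dual.notMem_A_of_notMem hF.dual hs hC (h.dual.notMem_A_of_mem_B hx)
      (h.dual.notMem_A_of_mem_B hy) h').elim

lemma eq_of_mem_spread (h : IsThreeLayer E A B C) (hF : Preserves E F) {a : V}
    (ha : a ∈ spread A F) : ∃ t ∈ A, ∀ a' ∈ A, F a a' = t := by
  obtain ⟨-, y, hy, hay⟩ := mem_spread.1 ha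
  exact ⟨_, hay, fun a' ha' => h.eq_of_le_A hay
    (hF _ _ _ _ (h.refl a) (h.le_of_notMem_A ha' hy))⟩

lemma card_sub_one_le (h : IsThreeLayer E A B C) (hF : Preserves E F)
    (hs : ∀ v, ∃ x y, F x y = v) (h₁ : (spread A F).Nonempty)
    (h₂ : (spread A (flip F)).Nonempty) :
    #A - 1 ≤ (#A - #(spread A F)) * (#A - #(spread A (flip F))) := by
  classical
  obtain ⟨a₁, ha₁⟩ := h₁
  obtain ⟨a₂, ha₂⟩ := h₂
  obtain ⟨t, ht, ht₁⟩ := h.eq_of_mem_spread hF ha₁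
  have e₂ : ∀ a' ∈ spread A (flip F), ∀ a ∈ A, F a a' = t := by
    intro a' ha' a ha
    obtain ⟨s, -, hs'⟩ := h.eq_of_mem_spread hF.swap ha'
    have := hs' a₁ (spread_subset ha₁)
    rw [← ht₁ a' (spread_subset ha')]
    exact (hs' a ha).trans this.symm
  have e₁ : ∀ a ∈ spread A F, ∀ a' ∈ A, F a a' = t := by
    intro a ha a' ha'
    obtain ⟨s, -, hs'⟩ := h.eq_of_mem_spread hF ha
    rw [hs' a' ha', ← hs' a₂ (spread_subset ha₂), e₂ a₂ ha₂ a (spread_subset ha)]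
  rw [← card_erase_of_mem ht, ← card_sdiff_of_subset spread_subset,
    ← card_sdiff_of_subset spread_subset, ← card_product]
  refine card_le_card_of_surjOn (fun p => F p.1 p.2) ?_
  intro s hsA
  simp only [coe_erase, Set.mem_sdiff, mem_coe, Set.mem_singleton_iff] at hsA
  obtain ⟨a, ha, a', ha', e⟩ := h.exists_A_preimage hF hs hsA.1
  refine ⟨(a, a'), ?_, e⟩
  simp only [coe_product, coe_sdiff, Set.mem_prod, Set.mem_sdiff, mem_coe]
  exact ⟨⟨ha, fun hh => hsA.2 (e.symm.trans (e₁ a hh a' ha'))⟩,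
    ⟨ha', fun hh => hsA.2 (e.symm.trans (e₂ a' hh a ha))⟩⟩

lemma const_left_of_spread_ne (h : IsThreeLayer E A B C) (hF : Preserves E F)
    (hB : ∀ b ∈ B, ∀ b' ∈ B, F b b' ∈ B) (hR : spread A F ≠ A) :
    ∀ b ∈ B, ∀ b' ∈ B, ∀ b'' ∈ B, F b b'' = F b' b'' := by
  obtain ⟨a, ha, haR⟩ : ∃ a ∈ A, a ∉ spread A F := by
    by_contra! hcon
    exact hR (spread_subset.antisymm hcon)
  have key : ∀ b ∈ B, ∀ b'' ∈ B, F a b'' = F b b'' := fun b hb b'' hb'' =>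
    h.eq_of_le_B (hB b hb b'' hb'')
      (fun hh => haR (mem_spread.2 ⟨ha, b'', h.notMem_A_of_mem_B hb'', hh⟩))
      (hF _ _ _ _ (h.le_AB a ha b hb) (h.refl b''))
  intro b hb b' hb' b'' hb''
  rw [← key b hb b'' hb'', key b' hb' b'' hb'']

/-- If `F` takes only the value `b₀` on `B × B` and a value in `B` other than `b₀` at a pair
with first entry in `A`, then that pair lies in `spread A F × C`. -/
lemma mem_spread_of_ne (h : IsThreeLayer E A B C) (hF : Preserves E F) {b₀ : V}
    (hb₀ : b₀ ∈ B) (hconst : ∀ b ∈ B, ∀ b' ∈ B, F b b' = b₀) {a y : V} (ha : a ∈ A)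
    (hy : F a y ∈ B) (hne : F a y ≠ b₀) : a ∈ spread A F ∧ y ∈ C := by
  have hyC : y ∈ C := by
    by_contra hyC
    have hyb : ∃ b ∈ B, E y b := by
      rcases h.cover y with h' | h' | h'
      · exact ⟨b₀, hb₀, h.le_AB y h' b₀ hb₀⟩
      · exact ⟨y, h', h.refl y⟩
      · exact (hyC h').elim
    obtain ⟨b, hb, hyb⟩ := hyb
    have := hF _ _ _ _ (h.le_AB a ha b₀ hb₀) hyb
    rw [hconst b₀ hb₀ b hb] at this
    exact hne (h.eq_B _ hy _ hb₀ this)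
  refine ⟨mem_spread.2 ⟨ha, b₀, h.notMem_A_of_mem_B hb₀, ?_⟩, hyC⟩
  by_contra hA
  have e₁ := h.eq_of_le_B hy hA (hF _ _ _ _ (h.refl a) (h.le_BC b₀ hb₀ y hyC))
  have e₂ : F a b₀ = b₀ := h.eq_of_le_B hb₀ hA
    (by simpa [hconst b₀ hb₀ b₀ hb₀] using hF _ _ _ _ (h.le_AB a ha b₀ hb₀) (h.refl b₀))
  exact hne (e₁.symm.trans e₂)

lemma card_B_le (h : IsThreeLayer E A B C) (hF : Preserves E F)
    (hs : ∀ v, ∃ x y, F x y = v) {b₀ : V}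
    (hb₀ : b₀ ∈ B) (hconst : ∀ b ∈ B, ∀ b' ∈ B, F b b' = b₀) :
    #B ≤ #(spread A F) * #(spread C (flip F)) + #(spread A (flip F)) * #(spread C F) + 1 := by
  classical
  have hsub : B.erase b₀ ⊆ (spread A F ×ˢ spread C (flip F)).image (fun p => F p.1 p.2) ∪
      (spread A (flip F) ×ˢ spread C F).image (fun p => F p.2 p.1) := by
    intro b hb
    obtain ⟨hne, hbB⟩ := mem_erase.1 hb
    obtain ⟨x, y, rfl⟩ := hs b
    have hconst' : ∀ b ∈ B, ∀ b' ∈ B, flip F b b' = b₀ := fun b hb b' hb' => hconst b' hb' b hb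
    have hAC : x ∈ A ∧ y ∈ C → x ∈ spread A F ∧ y ∈ spread C (flip F) := fun hxy =>
      ⟨(h.mem_spread_of_ne hF hb₀ hconst hxy.1 hbB hne).1,
        (h.dual.mem_spread_of_ne hF.swap.dual hb₀ hconst' hxy.2 hbB hne).1⟩
    have hCA : x ∈ C ∧ y ∈ A → x ∈ spread C F ∧ y ∈ spread A (flip F) := fun hxy =>
      ⟨(h.dual.mem_spread_of_ne hF.dual hb₀ hconst hxy.1 hbB hne).1,
        (h.mem_spread_of_ne hF.swap hb₀ hconst' hxy.2 hbB hne).1⟩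
    have hcases : x ∈ A ∧ y ∈ C ∨ x ∈ C ∧ y ∈ A := by
      rcases h.cover x with hx | hx | hx
      · exact Or.inl ⟨hx, (h.mem_spread_of_ne hF hb₀ hconst hx hbB hne).2⟩
      · rcases h.cover y with hy | hy | hy
        · exact (h.dual.notMem_A_of_mem_B hx
            (h.mem_spread_of_ne hF.swap hb₀ hconst' hy hbB hne).2).elim
        · exact (hne (hconst x hx y hy)).elim
        · exact (h.notMem_A_of_mem_B hx
            (h.dual.mem_spread_of_ne hF.swap.dual hb₀ hconst' hy hbB hne).2).elim
      · exact Or.inr ⟨hx, (h.dual.mem_spread_of_ne hF.dual hb₀ hconst hx hbB hne).2⟩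
    simp only [mem_union, mem_image, mem_product, Prod.exists]
    rcases hcases with hxy | hxy
    · exact Or.inl ⟨x, y, hAC hxy, rfl⟩
    · exact Or.inr ⟨y, x, (hCA hxy).symm, rfl⟩
  have := (card_le_card hsub).trans ((card_union_le _ _).trans
    (Nat.add_le_add card_image_le card_image_le))
  rw [card_erase_of_mem hb₀, card_product, card_product] at this
  omega

/-- If `F` ignores its second argument on `B × V` and is not constant on `B × B`, then it only
takes values in `A` on `A × V`. -/
lemma mem_A_of_not_const (h : IsThreeLayer E A B C) (hF : Preserves E F)
    (hB : ∀ b ∈ B, ∀ b' ∈ B, F b b' ∈ B) (hrow : ∀ b ∈ B, ∀ y z, F b y = F b z)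
    (hnc : ¬ ∃ b₀ ∈ B, ∀ b ∈ B, ∀ b' ∈ B, F b b' = b₀) (hBn : B.Nonempty) :
    ∀ a ∈ A, ∀ y, F a y ∈ A := by
  intro a ha y
  by_contra hy
  obtain ⟨b₁, hb₁⟩ := hBn
  have key : ∀ b ∈ B, F a y = F b b₁ := fun b hb => by
    refine h.eq_of_le_B (hB b hb b₁ hb₁) hy ?_
    rw [hrow b hb b₁ y]
    exact hF _ _ _ _ (h.le_AB a ha b hb) (h.refl y)
  exact hnc ⟨F b₁ b₁, hB _ hb₁ _ hb₁, fun b hb b' _ => by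
    rw [hrow b hb b' b₁, ← key b hb, key b₁ hb₁]⟩

lemma eq_on_A (h : IsThreeLayer E A B C) (hF : Preserves E F)
    (hA : ∀ a ∈ A, ∀ y, F a y ∈ A) {a : V} (ha : a ∈ A) (hBn : B.Nonempty) (y z : V) :
    F a y = F a z := by
  obtain ⟨b, hb⟩ := hBn
  have hbA := h.notMem_A_of_mem_B hb
  have key : ∀ a' ∈ A, ∀ w, w ∉ A → F a a' = F a w := fun a' ha' w hw =>
    h.eq_of_le_A (hA a ha w) (hF _ _ _ _ (h.refl a) (h.le_of_notMem_A ha' hw))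
  have key' : ∀ w, F a w = F a b := by
    intro w
    by_cases hw : w ∈ A
    · exact key w hw b hbA
    · rw [← key a ha w hw, key a ha b hbA]
  rw [key' y, key' z]

lemma eq_of_spread_eq (h : IsThreeLayer E A B C) (hF : Preserves E F)
    (hs : ∀ v, ∃ x y, F x y = v) (hA : 2 ≤ #A) (hB : 2 ≤ #B) (hC : 2 ≤ #C)
    (hR : spread A F = A) (hS : spread C F = C) (x y z : V) : F x y = F x z := by
  have hBB : ∀ b ∈ B, ∀ b' ∈ B, F b b' ∈ B := fun _ hb _ hb' =>
    h.mem_B_of_mem_B hF hs hA hC hb hb'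
  have hBn : B.Nonempty := card_pos.1 (by omega)
  have hAn : A.Nonempty := card_pos.1 (by omega)
  have hCn : C.Nonempty := card_pos.1 (by omega)
  have hR' : spread A (flip F) = ∅ := by
    by_contra hne
    have := h.card_sub_one_le hF hs (hR.symm ▸ hAn) (nonempty_iff_ne_empty.2 hne)
    rw [hR, Nat.sub_self, zero_mul] at this
    omega
  have hS' : spread C (flip F) = ∅ := by
    by_contra hne
    have := h.dual.card_sub_one_le hF.dual hs (hS.symm ▸ hCn) (nonempty_iff_ne_empty.2 hne)
    rw [hS, Nat.sub_self, zero_mul] at this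
    omega
  have hnc : ¬ ∃ b₀ ∈ B, ∀ b ∈ B, ∀ b' ∈ B, F b b' = b₀ := by
    rintro ⟨b₀, hb₀, hconst⟩
    have := h.card_B_le hF hs hb₀ hconst
    simp only [hR', hS', card_empty, mul_zero, zero_mul] at this
    omega
  have hrow : ∀ b ∈ B, ∀ y z, F b y = F b z := by
    intro b hb
    obtain ⟨a, ha⟩ := hAn
    have hba : ∀ a ∈ A, ∀ b' ∈ B, F b a = F b b' := fun a ha b' hb' =>
      h.eq_of_le_B (hBB b hb b' hb')
        (fun hh => by
          have : a ∈ spread A (flip F) := mem_spread.2 ⟨ha, b, h.notMem_A_of_mem_B hb, hh⟩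
          simp [hR'] at this)
        (hF _ _ _ _ (h.refl b) (h.le_AB a ha b' hb'))
    have hbc : ∀ c ∈ C, ∀ b' ∈ B, F b c = F b b' := fun c hc b' hb' =>
      h.dual.eq_of_le_B (hBB b hb b' hb')
        (fun hh => by
          have : c ∈ spread C (flip F) := mem_spread.2 ⟨hc, b, h.dual.notMem_A_of_mem_B hb, hh⟩
          simp [hS'] at this)
        (hF _ _ _ _ (h.refl b) (h.le_BC b' hb' c hc))
    have key : ∀ y, F b y = F b a := by
      intro y
      rcases h.cover y with hy | hy | hy
      · rw [hba y hy b hb, hba a ha b hb]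
      · rw [hba a ha y hy]
      · rw [hbc y hy b hb, hba a ha b hb]
    exact fun y z => (key y).trans (key z).symm
  rcases h.cover x with hx | hx | hx
  · exact h.eq_on_A hF (h.mem_A_of_not_const hF hBB hrow hnc hBn) hx hBn y z
  · exact hrow x hx y z
  · exact h.dual.eq_on_A hF.dual (h.dual.mem_A_of_not_const hF.dual hBB hrow hnc hBn)
      hx hBn y z

end IsThreeLayer

end ThreeLayer

lemma bddAbove_muBound (m k : ℕ) : BddAbove { v : ℕ | ∃ α β γ δ : ℕ,
    0 < α ∧ α < m ∧ 0 < β ∧ β < m ∧ 0 < γ ∧ γ < k ∧ 0 < δ ∧ δ < k ∧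
    m - 1 ≤ (m - α) * (m - β) ∧ k - 1 ≤ (k - γ) * (k - δ) ∧
    v = α * γ + β * δ } := by
  refine ⟨m * k + m * k, ?_⟩
  rintro v ⟨α, β, γ, δ, -, hα, -, hβ, -, hγ, -, hδ, -, -, rfl⟩
  gcongr

/-- Either a binary polymorphism depends on one coordinate only, or the middle layer is
small. -/
lemma IsThreeLayer.eq_or_eq_or_card_le {V : Type*} {E : V → V → Prop} {A B C : Finset V}
    {F : V → V → V} (h : IsThreeLayer E A B C) (hF : Preserves E F)
    (hs : ∀ v, ∃ x y, F x y = v) (hA : 2 ≤ #A) (hB : 2 ≤ #B) (hC : 2 ≤ #C) :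
    (∀ x y z, F x y = F x z) ∨ (∀ x y z, F y x = F z x) ∨ #B ≤ Bmk #A #C + 1 := by
  by_cases h₁ : spread A F = A ∧ spread C F = C
  · exact Or.inl (h.eq_of_spread_eq hF hs hA hB hC h₁.1 h₁.2)
  by_cases h₂ : spread A (flip F) = A ∧ spread C (flip F) = C
  · refine Or.inr (Or.inl (h.eq_of_spread_eq hF.swap ?_ hA hB hC h₂.1 h₂.2))
    intro v
    obtain ⟨x, y, e⟩ := hs v
    exact ⟨y, x, e⟩
  refine Or.inr (Or.inr ?_)
  have hs' : ∀ v, ∃ x y, flip F x y = v := fun v => by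
    obtain ⟨x, y, e⟩ := hs v
    exact ⟨y, x, e⟩
  have hBB : ∀ b ∈ B, ∀ b' ∈ B, F b b' ∈ B := fun _ hb _ hb' =>
    h.mem_B_of_mem_B hF hs hA hC hb hb'
  have hBB' : ∀ b ∈ B, ∀ b' ∈ B, flip F b b' ∈ B := fun b hb b' hb' => hBB b' hb' b hb
  have hl : ∀ b ∈ B, ∀ b' ∈ B, ∀ b'' ∈ B, F b b'' = F b' b'' := by
    rcases not_and_or.1 h₁ with h' | h'
    · exact h.const_left_of_spread_ne hF hBB h'
    · exact h.dual.const_left_of_spread_ne hF.dual hBB h'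
  have hr : ∀ b ∈ B, ∀ b' ∈ B, ∀ b'' ∈ B, F b'' b = F b'' b' := by
    rcases not_and_or.1 h₂ with h' | h'
    · exact h.const_left_of_spread_ne hF.swap hBB' h'
    · exact h.dual.const_left_of_spread_ne hF.swap.dual hBB' h'
  obtain ⟨b, hb⟩ : B.Nonempty := card_pos.1 (by omega)
  refine (h.card_B_le hF hs (hBB b hb b hb)
    (fun x hx y hy => (hl x hx b hb y hy).trans (hr y hy b hb b hb))).trans ?_
  refine Nat.add_le_add_right ?_ 1
  have hα := card_le_card (spread_subset (A := A) (F := F))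
  have hβ := card_le_card (spread_subset (A := A) (F := flip F))
  have hγ := card_le_card (spread_subset (A := C) (F := flip F))
  have hδ := card_le_card (spread_subset (A := C) (F := F))
  have hlow := h.card_sub_one_le hF hs
  have hup := h.dual.card_sub_one_le hF.swap.dual hs'
  simp only [← card_pos] at hlow hup
  change _ → 0 < #(spread C F) → _ ≤ _ * (_ - #(spread C F)) at hup
  generalize #(spread A F) = α at *
  generalize #(spread A (flip F)) = β at *
  generalize #(spread C (flip F)) = γ at *
  generalize #(spread C F) = δ at *
  have hle₁ : α * γ ≤ #A * #C := Nat.mul_le_mul hα hγ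
  have hle₂ : β * δ ≤ #A * #C := Nat.mul_le_mul hβ hδ
  rcases Nat.eq_zero_or_pos α with rfl | hα0
  · exact le_max_of_le_right (by simpa using hle₂)
  rcases Nat.eq_zero_or_pos β with rfl | hβ0
  · exact le_max_of_le_right (by simpa using hle₁)
  rcases Nat.eq_zero_or_pos γ with rfl | hγ0
  · exact le_max_of_le_right (by simpa using hle₂)
  rcases Nat.eq_zero_or_pos δ with rfl | hδ0
  · exact le_max_of_le_right (by simpa using hle₁)
  have hlow := hlow hα0 hβ0
  have hup := hup hγ0 hδ0
  have hp := pos_of_mul_pos_left (a := #A - α) (b := #A - β) (by omega) (Nat.zero_le _)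
  have hp' := pos_of_mul_pos_right (a := #A - α) (b := #A - β) (by omega) (Nat.zero_le _)
  have hq := pos_of_mul_pos_left (a := #C - γ) (b := #C - δ) (by omega) (Nat.zero_le _)
  have hq' := pos_of_mul_pos_right (a := #C - γ) (b := #C - δ) (by omega) (Nat.zero_le _)
  exact le_max_of_le_left (le_csSup (bddAbove_muBound _ _)
    ⟨α, β, γ, δ, hα0, by omega, hβ0, by omega, hγ0, by omega, hδ0, by omega, hlow, hup, rfl⟩)

lemma ordSum3_isThreeLayer (m n k : ℕ) :
    IsThreeLayer (ordSum3 m n k) (univ.map ⟨Sum.inl, Sum.inl_injective⟩)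
      (univ.map ⟨fun b => Sum.inr (Sum.inl b), Sum.inr_injective.comp Sum.inl_injective⟩)
      (univ.map ⟨fun c => Sum.inr (Sum.inr c), Sum.inr_injective.comp Sum.inr_injective⟩) := by
  constructor <;> simp [ordSum3]

/-- A finite set with at least `|Y| - 1` elements can be mapped onto all elements of `Y`
other than `y₀`, everything else being sent to `y₀`. -/
lemma exists_map_onto_ne {X Y : Type*} [Fintype Y] (S : Finset X) (y₀ : Y)
    (hS : Fintype.card Y ≤ #S + 1) :
    ∃ g : X → Y, (∀ x, x ∉ S → g x = y₀) ∧ ∀ y, y ≠ y₀ → ∃ x ∈ S, g x = y := by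
  classical
  have hcard : Fintype.card {y // y ≠ y₀} ≤ Fintype.card S := by
    rw [Fintype.card_coe, Fintype.card_subtype_compl, Fintype.card_subtype_eq]
    omega
  obtain ⟨e⟩ := Function.Embedding.nonempty_of_card_le hcard
  refine ⟨fun x => if hx : ∃ y, (e y : X) = x then hx.choose else y₀, ?_, ?_⟩
  · intro x hx
    refine dif_neg ?_
    rintro ⟨y, rfl⟩
    exact hx (e y).2
  · intro y hy
    refine ⟨e ⟨y, hy⟩, (e _).2, ?_⟩
    have hx : ∃ z, (e z : X) = e ⟨y, hy⟩ := ⟨_, rfl⟩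
    have := e.injective (Subtype.ext hx.choose_spec)
    simp only [dif_pos hx]
    rw [this]

section Constructions

variable {m n k : ℕ}

/-- The operation reading off the bottom layer from the first coordinate and the top layer
from the second one. -/
def splitOp (b₀ : Fin n) (q : Fin m × Fin k → Fin n) :
    Fin m ⊕ Fin n ⊕ Fin k → Fin m ⊕ Fin n ⊕ Fin k → Fin m ⊕ Fin n ⊕ Fin k
  | Sum.inl a, Sum.inl _ => Sum.inl a
  | Sum.inl a, Sum.inr (Sum.inl _) => Sum.inl a
  | Sum.inl a, Sum.inr (Sum.inr c) => Sum.inr (Sum.inl (q (a, c)))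
  | Sum.inr _, Sum.inr (Sum.inr c) => Sum.inr (Sum.inr c)
  | Sum.inr _, Sum.inl _ => Sum.inr (Sum.inl b₀)
  | Sum.inr _, Sum.inr (Sum.inl _) => Sum.inr (Sum.inl b₀)

lemma splitOp_preserves (b₀ : Fin n) (q : Fin m × Fin k → Fin n) :
    Preserves (ordSum3 m n k) (splitOp b₀ q) := by
  rintro (a | b | c) (a' | b' | c') (d | e | f) (d' | e' | f') hx hy <;>
    simp_all [ordSum3, splitOp]

/-- The operation contracting the crosses determined by `R₁`, `R₂` in the bottom layer and by
`S₁`, `S₂` in the top layer. -/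
def crossOp (a₀ : Fin m) (b₀ : Fin n) (c₀ : Fin k) (R₁ R₂ : Finset (Fin m))
    (S₁ S₂ : Finset (Fin k)) (p : Fin m × Fin m → Fin m) (r : Fin k × Fin k → Fin k)
    (q : Fin m × Fin k ⊕ Fin m × Fin k → Fin n) :
    Fin m ⊕ Fin n ⊕ Fin k → Fin m ⊕ Fin n ⊕ Fin k → Fin m ⊕ Fin n ⊕ Fin k
  | Sum.inl a, Sum.inl a' => Sum.inl (p (a, a'))
  | Sum.inl a, Sum.inr (Sum.inl _) => if a ∈ R₁ then Sum.inl a₀ else Sum.inr (Sum.inl b₀)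
  | Sum.inl a, Sum.inr (Sum.inr c) => Sum.inr (Sum.inl (q (Sum.inl (a, c))))
  | Sum.inr (Sum.inl _), Sum.inl a => if a ∈ R₂ then Sum.inl a₀ else Sum.inr (Sum.inl b₀)
  | Sum.inr (Sum.inl _), Sum.inr (Sum.inl _) => Sum.inr (Sum.inl b₀)
  | Sum.inr (Sum.inl _), Sum.inr (Sum.inr c) =>
    if c ∈ S₁ then Sum.inr (Sum.inr c₀) else Sum.inr (Sum.inl b₀)
  | Sum.inr (Sum.inr c), Sum.inl a => Sum.inr (Sum.inl (q (Sum.inr (a, c))))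
  | Sum.inr (Sum.inr c), Sum.inr (Sum.inl _) =>
    if c ∈ S₂ then Sum.inr (Sum.inr c₀) else Sum.inr (Sum.inl b₀)
  | Sum.inr (Sum.inr c), Sum.inr (Sum.inr c') => Sum.inr (Sum.inr (r (c, c')))

lemma crossOp_preserves {a₀ : Fin m} {b₀ : Fin n} {c₀ : Fin k} {R₁ R₂ : Finset (Fin m)}
    {S₁ S₂ : Finset (Fin k)} {p : Fin m × Fin m → Fin m} {r : Fin k × Fin k → Fin k}
    {q : Fin m × Fin k ⊕ Fin m × Fin k → Fin n}
    (hp : ∀ x, x ∉ R₁ᶜ ×ˢ R₂ᶜ → p x = a₀) (hr : ∀ x, x ∉ S₂ᶜ ×ˢ S₁ᶜ → r x = c₀)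
    (hq : ∀ x, x ∉ (R₁ ×ˢ S₁).disjSum (R₂ ×ˢ S₂) → q x = b₀) :
    Preserves (ordSum3 m n k) (crossOp a₀ b₀ c₀ R₁ R₂ S₁ S₂ p r q) := by
  have hp₁ : ∀ a a', a ∈ R₁ → p (a, a') = a₀ := fun a a' h => hp _ (by simp [h])
  have hp₂ : ∀ a a', a' ∈ R₂ → p (a, a') = a₀ := fun a a' h => hp _ (by simp [h])
  have hr₁ : ∀ a a', a' ∈ S₁ → r (a, a') = c₀ := fun a a' h => hr _ (by simp [h])
  have hr₂ : ∀ a a', a ∈ S₂ → r (a, a') = c₀ := fun a a' h => hr _ (by simp [h])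
  have hq₁ : ∀ a c, a ∉ R₁ → q (Sum.inl (a, c)) = b₀ := fun a c h => hq _ (by simp [h])
  have hq₂ : ∀ a c, c ∉ S₁ → q (Sum.inl (a, c)) = b₀ := fun a c h => hq _ (by simp [h])
  have hq₃ : ∀ a c, a ∉ R₂ → q (Sum.inr (a, c)) = b₀ := fun a c h => hq _ (by simp [h])
  have hq₄ : ∀ a c, c ∉ S₂ → q (Sum.inr (a, c)) = b₀ := fun a c h => hq _ (by simp [h])
  clear hp hr hq
  rintro (a | b | c) (a' | b' | c') (d | e | f) (d' | e' | f') hx hy <;>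
    simp only [ordSum3] at hx hy <;> subst_vars <;> simp only [crossOp] <;>
    (try split_ifs) <;> simp_all [ordSum3]

end Constructions

/-- A surjective binary polymorphism depending on both coordinates witnesses failure of the
2-Słupecki property. -/
lemma exists_not_essUnary {V : Type*} {E : V → V → Prop} {F : V → V → V}
    (hF : Preserves E F) (hs : ∀ v, ∃ x y, F x y = v)
    (h₁ : ∃ x y z, F x y ≠ F x z) (h₂ : ∃ x y z, F y x ≠ F z x) :
    ¬ ∀ f : (Fin 2 → V) → V, IsHom (PowE E 2) E f → Function.Surjective f →
      EssUnary E f := by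
  intro h
  obtain ⟨i, g, -, hg⟩ := h (fun v => F (v 0) (v 1))
    (fun x y hxy => hF _ _ _ _ (hxy 0) (hxy 1))
    (fun v => by
      obtain ⟨x, y, e⟩ := hs v
      exact ⟨![x, y], by simpa using e⟩)
  obtain ⟨x, y, z, hne⟩ := h₁
  obtain ⟨x', y', z', hne'⟩ := h₂
  have e₁ := hg ![x, y]
  have e₂ := hg ![x, z]
  have e₃ := hg ![y', x']
  have e₄ := hg ![z', x']
  fin_cases i <;> simp_all

/-- A binary operation depending on one coordinate only is essentially unary. -/
lemma essUnary_of_eq {V : Type*} {E : V → V → Prop}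
    {f : (Fin 2 → V) → V} (hf : IsHom (PowE E 2) E f)
    (h : (∀ x y z, f ![x, y] = f ![x, z]) ∨ ∀ x y z, f ![y, x] = f ![z, x]) :
    EssUnary E f := by
  have hdiag : IsHom E E (fun x => f ![x, x]) := fun x y hxy => hf _ _ (fun i => by
    fin_cases i <;> simpa using hxy)
  have heta : ∀ v : Fin 2 → V, v = ![v 0, v 1] := fun v => by
    ext i; fin_cases i <;> rfl
  rcases h with h | h
  · refine ⟨0, _, hdiag, fun v => ?_⟩
    conv_lhs => rw [heta v]
    exact h _ _ _
  · refine ⟨1, _, hdiag, fun v => ?_⟩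
    conv_lhs => rw [heta v]
    exact h _ _ _

lemma not_slupecki_of_le_mul {m n k : ℕ} (hm : 2 ≤ m) (hn : 2 ≤ n) (hk : 2 ≤ k)
    (h : n ≤ m * k + 1) :
    ¬ ∀ f : (Fin 2 → (Fin m ⊕ Fin n ⊕ Fin k)) → (Fin m ⊕ Fin n ⊕ Fin k),
      IsHom (PowE (ordSum3 m n k) 2) (ordSum3 m n k) f →
      Function.Surjective f → EssUnary (ordSum3 m n k) f := by
  let a₀ : Fin m := ⟨0, by omega⟩
  let b₀ : Fin n := ⟨0, by omega⟩
  let c₀ : Fin k := ⟨0, by omega⟩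
  obtain ⟨q, -, hq⟩ := exists_map_onto_ne (univ : Finset (Fin m × Fin k)) b₀ (by simpa using h)
  refine exists_not_essUnary (splitOp_preserves b₀ q) ?_
    ⟨Sum.inl a₀, Sum.inl a₀, Sum.inr (Sum.inr c₀), by simp [splitOp]⟩
    ⟨Sum.inr (Sum.inr c₀), Sum.inl a₀, Sum.inr (Sum.inl b₀), by simp [splitOp]⟩
  rintro (a | b | c)
  · exact ⟨Sum.inl a, Sum.inl a, rfl⟩
  · by_cases hb : b = b₀
    · exact ⟨Sum.inr (Sum.inl b₀), Sum.inl a₀, by simp [splitOp, hb]⟩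
    · obtain ⟨⟨a, c⟩, -, e⟩ := hq b hb
      exact ⟨Sum.inl a, Sum.inr (Sum.inr c), by simp [splitOp, e]⟩
  · exact ⟨Sum.inr (Sum.inr c), Sum.inr (Sum.inr c), rfl⟩

lemma not_slupecki_of_le_muBound {m n k : ℕ} (hn : 2 ≤ n) (h : n ≤ muBound m k + 1) :
    ¬ ∀ f : (Fin 2 → (Fin m ⊕ Fin n ⊕ Fin k)) → (Fin m ⊕ Fin n ⊕ Fin k),
      IsHom (PowE (ordSum3 m n k) 2) (ordSum3 m n k) f →
      Function.Surjective f → EssUnary (ordSum3 m n k) f := by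
  have hne : { v : ℕ | ∃ α β γ δ : ℕ,
      0 < α ∧ α < m ∧ 0 < β ∧ β < m ∧ 0 < γ ∧ γ < k ∧ 0 < δ ∧ δ < k ∧
      m - 1 ≤ (m - α) * (m - β) ∧ k - 1 ≤ (k - γ) * (k - δ) ∧
      v = α * γ + β * δ }.Nonempty := by
    by_contra hempty
    rw [Set.not_nonempty_iff_eq_empty] at hempty
    rw [muBound, hempty, csSup_empty] at h
    simp only [bot_eq_zero'] at h
    omega
  obtain ⟨α, β, γ, δ, hα0, hα, hβ0, hβ, hγ0, hγ, hδ0, hδ, hm, hk, e⟩ :=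
    Nat.sSup_mem hne (bddAbove_muBound m k)
  change muBound m k = _ at e
  rw [e] at h
  let a₀ : Fin m := ⟨0, by omega⟩
  let b₀ : Fin n := ⟨0, by omega⟩
  let c₀ : Fin k := ⟨0, by omega⟩
  obtain ⟨R₁, -, hR₁⟩ := exists_subset_card_eq (s := (univ : Finset (Fin m))) (n := α)
    (by simpa using hα.le)
  obtain ⟨R₂, -, hR₂⟩ := exists_subset_card_eq (s := (univ : Finset (Fin m))) (n := β)
    (by simpa using hβ.le)
  obtain ⟨S₁, -, hS₁⟩ := exists_subset_card_eq (s := (univ : Finset (Fin k))) (n := γ)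
    (by simpa using hγ.le)
  obtain ⟨S₂, -, hS₂⟩ := exists_subset_card_eq (s := (univ : Finset (Fin k))) (n := δ)
    (by simpa using hδ.le)
  obtain ⟨p, hp, hp'⟩ := exists_map_onto_ne (R₁ᶜ ×ˢ R₂ᶜ) a₀ (by
    simp only [card_product, card_compl, Fintype.card_fin, hR₁, hR₂]
    omega)
  obtain ⟨r, hr, hr'⟩ := exists_map_onto_ne (S₂ᶜ ×ˢ S₁ᶜ) c₀ (by
    simp only [card_product, card_compl, Fintype.card_fin, hS₁, hS₂]
    rw [mul_comm]
    omega)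
  obtain ⟨q, hq, hq'⟩ := exists_map_onto_ne ((R₁ ×ˢ S₁).disjSum (R₂ ×ˢ S₂)) b₀ (by
    simpa only [card_disjSum, card_product, Fintype.card_fin, hR₁, hR₂, hS₁, hS₂] using h)
  obtain ⟨a₁, ha₁⟩ : R₁.Nonempty := card_pos.1 (by omega)
  obtain ⟨a₂, ha₂⟩ : R₂.Nonempty := card_pos.1 (by omega)
  obtain ⟨c₁, hc₁⟩ : S₁.Nonempty := card_pos.1 (by omega)
  refine exists_not_essUnary (crossOp_preserves hp hr hq) ?_
    ⟨Sum.inr (Sum.inl b₀), Sum.inl a₂, Sum.inr (Sum.inl b₀), by simp [crossOp, ha₂]⟩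
    ⟨Sum.inr (Sum.inl b₀), Sum.inl a₁, Sum.inr (Sum.inl b₀), by simp [crossOp, ha₁]⟩
  rintro (a | b | c)
  · by_cases ha : a = a₀
    · exact ⟨Sum.inl a₁, Sum.inr (Sum.inl b₀), by simp [crossOp, ha₁, ha]⟩
    · obtain ⟨⟨x, y⟩, -, e⟩ := hp' a ha
      exact ⟨Sum.inl x, Sum.inl y, by simp [crossOp, e]⟩
  · by_cases hb : b = b₀
    · exact ⟨Sum.inr (Sum.inl b₀), Sum.inr (Sum.inl b₀), by simp [crossOp, hb]⟩
    · obtain ⟨⟨x, y⟩ | ⟨x, y⟩, -, e⟩ := hq' b hb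
      · exact ⟨Sum.inl x, Sum.inr (Sum.inr y), by simp [crossOp, e]⟩
      · exact ⟨Sum.inr (Sum.inr y), Sum.inl x, by simp [crossOp, e]⟩
  · by_cases hc : c = c₀
    · exact ⟨Sum.inr (Sum.inl b₀), Sum.inr (Sum.inr c₁), by simp [crossOp, hc₁, hc]⟩
    · obtain ⟨⟨x, y⟩, -, e⟩ := hr' c hc
      exact ⟨Sum.inr (Sum.inr x), Sum.inr (Sum.inr y), by simp [crossOp, e]⟩

theorem stmt19 (m n k : ℕ) (hm : 2 ≤ m) (hn : 2 ≤ n) (hk : 2 ≤ k) :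
    (∀ f : (Fin 2 → (Fin m ⊕ Fin n ⊕ Fin k)) → (Fin m ⊕ Fin n ⊕ Fin k),
      IsHom (PowE (ordSum3 m n k) 2) (ordSum3 m n k) f →
      Function.Surjective f → EssUnary (ordSum3 m n k) f) ↔
    Bmk m k + 1 < n := by
  constructor
  · intro h
    by_contra hcon
    rcases le_total (muBound m k) (m * k) with hle | hle
    · rw [Bmk, max_eq_right hle] at hcon
      exact not_slupecki_of_le_mul hm hn hk (by omega) h
    · rw [Bmk, max_eq_left hle] at hcon
      exact not_slupecki_of_le_muBound hn (by omega) h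
  · intro h f hf hs
    have hL := ordSum3_isThreeLayer m n k
    have key := hL.eq_or_eq_or_card_le (F := fun x y => f ![x, y])
      (fun x x' y y' hx hy => hf _ _ (fun i => by fin_cases i <;> simpa))
      (fun v => by
        obtain ⟨w, rfl⟩ := hs v
        refine ⟨w 0, w 1, congrArg f ?_⟩
        ext i
        fin_cases i <;> rfl)
      (by simpa using hm) (by simpa using hn) (by simpa using hk)
    simp only [card_map, card_univ, Fintype.card_fin] at key
    refine essUnary_of_eq hf ?_
    rcases key with h' | h' | h'
    · exact Or.inl h'
    · exact Or.inr h'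
    · omega
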